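/- arXiv:2510.15932 — 2 statements merged into one kernel-verified Lean document; each statement's English description precedes it below -/
import Mathlib

section
/- Let F be a field of characteristic zero, let A, B ∈ Mₙ(F), and let k be a positive integer. If Ker Ad_A^k = Ann_k(B) and Ker Ad_B^k = Ann_k(A), then A and B are polynomially equivalent. -/
/-- The adjoint map `Ad_A : X ↦ AX - XA`. -/
def adFun {n : ℕ} {F : Type*} [Field F] (A : Matrix (Fin n) (Fin n) F) :
    Matrix (Fin n) (Fin n) F → Matrix (Fin n) (Fin n) F :=
  fun X => A * X - X * A

/-- The kernel of the `k`-fold composition of `Ad_A`. -/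
def kerAdPow {n : ℕ} {F : Type*} [Field F] (A : Matrix (Fin n) (Fin n) F) (k : ℕ) :
    Set (Matrix (Fin n) (Fin n) F) :=
  {X | (adFun A)^[k] X = 0}

/-- The `k`-th annihilator of `B`: all `X` with `Ad_X^k (B) = 0`. -/
def annPow {n : ℕ} {F : Type*} [Field F] (B : Matrix (Fin n) (Fin n) F) (k : ℕ) :
    Set (Matrix (Fin n) (Fin n) F) :=
  {X | (adFun X)^[k] B = 0}

/-- `A` and `B` are polynomially equivalent: each is a polynomial in the other. -/
def PolyEquiv {n : ℕ} {F : Type*} [Field F] (A B : Matrix (Fin n) (Fin n) F) : Prop :=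
  ∃ f g : Polynomial F, B = Polynomial.aeval A f ∧ A = Polynomial.aeval B g

open Polynomial

attribute [local instance] LieRing.ofAssociativeRing

section DoubleCentralizer

/-- A commutative algebra generated by one integral element over a field is self-injective. -/
lemma Algebra.baer_adjoin_singleton {F R : Type*} [Field F] [Ring R] [Algebra F R] {a : R}
    (ha : IsIntegral F a) :
    Module.Baer (Algebra.adjoin F {a}) (Algebra.adjoin F {a}) := by
  intro I g
  set a' : Algebra.adjoin F {a} := ⟨a, Algebra.self_mem_adjoin_singleton F a⟩
  have hcoe (p : F[X]) : ((aeval a' p : Algebra.adjoin F {a}) : R) = aeval a p := by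
    simp [a', coe_aeval_mk_apply]
  have hsurj (x : Algebra.adjoin F {a}) : ∃ p : F[X], aeval a' p = x := by
    obtain ⟨x, hx⟩ := x
    rw [Algebra.adjoin_singleton_eq_range_aeval] at hx
    obtain ⟨p, rfl⟩ := hx
    exact ⟨p, Subtype.ext (hcoe p)⟩
  obtain ⟨p, hp⟩ := IsPrincipalIdealRing.principal (I.comap (aeval a' : F[X] →ₐ[F] _))
  have hmem (q : F[X]) : aeval a' q ∈ I ↔ p ∣ q := by
    rw [← Ideal.mem_span_singleton, ← Ideal.submodule_span_eq, ← hp, Ideal.mem_comap]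
  have hpI : aeval a' p ∈ I := (hmem p).2 dvd_rfl
  have hm : aeval a' (minpoly F a) = 0 := Subtype.ext (by simp [hcoe])
  obtain ⟨b, hb⟩ : p ∣ minpoly F a := (hmem _).1 (by simp [hm])
  obtain ⟨f, hf⟩ := hsurj (g ⟨aeval a' p, hpI⟩)
  have hbf : aeval a' (b * f) = 0 := by
    rw [map_mul, hf, ← smul_eq_mul, ← map_smul]
    convert map_zero g
    refine Subtype.ext ?_
    simp [← map_mul, mul_comm b p, ← hb, hm]
  have hdvd : p * b ∣ f * b := by
    rw [← hb, mul_comm]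
    exact minpoly.dvd F a (by rw [← hcoe, hbf]; rfl)
  have hb0 : b ≠ 0 := by
    rintro rfl
    exact minpoly.ne_zero ha (by simpa using hb)
  obtain ⟨t, rfl⟩ := (mul_dvd_mul_iff_right hb0).1 hdvd
  refine ⟨LinearMap.toSpanSingleton _ _ (aeval a' t), fun x hx ↦ ?_⟩
  obtain ⟨q, rfl⟩ := hsurj x
  obtain ⟨s, rfl⟩ := (hmem q).1 hx
  have : (⟨aeval a' (p * s), hx⟩ : I) = aeval a' s • ⟨aeval a' p, hpI⟩ :=
    Subtype.ext (by simp [mul_comm p s])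
  rw [this, map_smul, ← hf]
  simp only [LinearMap.toSpanSingleton_apply, smul_eq_mul, ← map_mul]
  congr 1
  ring

variable {F V : Type*} [Field F] [AddCommGroup V] [Module F V] [FiniteDimensional F V]

/-- A linear endomorphism of `End V` commuting with left multiplication by `a` commutes with left
multiplication by every element of the double centralizer of `a`. -/
lemma Module.End.map_mul_of_forall_commute {a b : Module.End F V}
    (hb : ∀ c, Commute a c → Commute b c)
    (φ : Module.End F V →ₗ[F] Module.End F V) (hφ : ∀ x, φ (a * x) = a * φ x) :
    φ b = b * φ 1 := by
  have rank_one (f : V →ₗ[F] F) (w : V) : φ (b * f.smulRight w) = b * φ (f.smulRight w) := by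
    ext v
    let c : Module.End F V :=
      LinearMap.applyₗ v ∘ₗ φ ∘ₗ LinearMap.smulRightₗ f
    have hc (w : V) : c w = φ (f.smulRight w) v := rfl
    have hm (m : Module.End F V) (w : V) : m * f.smulRight w = f.smulRight (m w) := by
      ext; simp
    have hac : Commute a c := by
      ext w
      simp only [Module.End.mul_apply, hc]
      rw [← hm, hφ]; rfl
    have := LinearMap.congr_fun (hb c hac) w
    simp only [Module.End.mul_apply, hc] at this
    rw [hm, ← this]; rfl
  let e := Module.finBasis F V
  have h1 : (1 : Module.End F V) = ∑ i, (e.coord i).smulRight (e i) := by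
    ext v
    simp [LinearMap.sum_apply, e.sum_repr]
  calc φ b = φ (b * 1) := by rw [mul_one]
    _ = b * φ 1 := by rw [h1]; simp [Finset.mul_sum, rank_one]

/-- The double centralizer theorem for a single endomorphism. -/
theorem Module.End.mem_adjoin_singleton_of_forall_commute {a b : Module.End F V}
    (hb : ∀ c, Commute a c → Commute b c) : b ∈ Algebra.adjoin F {a} := by
  have hinj := (Algebra.baer_adjoin_singleton (Algebra.IsIntegral.isIntegral (R := F) a)).injective
  let K := Algebra.adjoin F {a}
  let i : K →ₗ[K] Module.End F V := LinearMap.toSpanSingleton K _ 1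
  have hi (x : K) : i x = x := by simp [i, Subalgebra.smul_def]
  obtain ⟨π, hπ⟩ := hinj.out i (fun x y h ↦ Subtype.ext (by rwa [hi, hi] at h)) LinearMap.id
  let φ : Module.End F V →ₗ[F] Module.End F V :=
    K.val.toLinearMap ∘ₗ π.restrictScalars F
  have hφ (x) : φ x = π x := rfl
  have h1 : φ 1 = 1 := by
    have := hπ 1
    rw [hi] at this
    simpa [hφ] using congrArg (Subtype.val) this
  have := Module.End.map_mul_of_forall_commute hb φ fun x ↦ by
    have := congrArg Subtype.val (map_smul π (⟨a, Algebra.self_mem_adjoin_singleton F a⟩ : K) x)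
    rw [hφ, hφ]
    simpa [Subalgebra.smul_def] using this
  rw [h1, mul_one] at this
  rw [← this]
  exact (π b).2

end DoubleCentralizer

section AdjointAction

variable {F V : Type*} [Field F] [AddCommGroup V] [Module F V]

lemma Module.End.mem_maxGenEigenspace_of_isNilpotent_sub {f g : Module.End F V} (hc : Commute f g)
    (hn : IsNilpotent (g - f)) {μ : F} {v : V} (hv : v ∈ f.maxGenEigenspace μ) :
    v ∈ g.maxGenEigenspace μ := by
  rw [mem_maxGenEigenspace] at hv ⊢
  obtain ⟨k, hk⟩ := hv
  obtain ⟨m, hm⟩ := hn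
  refine ⟨k + m, ?_⟩
  have hcomm : Commute (f - μ • 1) (g - f) := by
    refine (hc.sub_right (Commute.refl f)).sub_left ?_
    exact (Commute.one_left _).smul_left μ
  rw [show g - μ • (1 : Module.End F V) = (f - μ • 1) + (g - f) by abel, hcomm.add_pow',
    LinearMap.sum_apply]
  refine Finset.sum_eq_zero fun ij hij ↦ ?_
  rw [Finset.HasAntidiagonal.mem_antidiagonal] at hij
  rw [LinearMap.smul_apply]
  obtain h | h : k ≤ ij.1 ∨ m ≤ ij.2 := by omega
  · rw [(hcomm.pow_pow _ _).eq, Module.End.mul_apply,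
      show ij.1 = (ij.1 - k) + k by omega, pow_add, Module.End.mul_apply, hk]
    simp
  · rw [pow_eq_zero_of_le h hm]
    simp

lemma LieAlgebra.ad_ofAssociative_apply {R : Type*} [Ring R] [Algebra F R] (x y : R) :
    LieAlgebra.ad F R x y = x * y - y * x := rfl

variable [FiniteDimensional F V]

/-- The semisimple part `s` of `n + s` acts by a scalar on each generalized eigenspace
of `ad (n + s)`. -/
lemma LieAlgebra.ad_apply_eq_smul_of_mem_maxGenEigenspace [PerfectField F]
    {n s y : Module.End F V} (hc : Commute n s)
    (hn : IsNilpotent n) (hs : s.IsSemisimple) {μ : F}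
    (hy : y ∈ (LieAlgebra.ad F _ (n + s)).maxGenEigenspace μ) :
    LieAlgebra.ad F _ s y = μ • y := by
  have hss := (LieAlgebra.ad_isSemisimple_of_isSemisimple hs).isFinitelySemisimple
  rw [← Module.End.mem_eigenspace_iff, ← hss.maxGenEigenspace_eq_eigenspace]
  refine Module.End.mem_maxGenEigenspace_of_isNilpotent_sub
    (LieAlgebra.commute_ad_of_commute (hc.add_left (Commute.refl s))) ?_ hy
  rw [← map_sub, show s - (n + s) = -n by abel]
  exact LieAlgebra.ad_nilpotent_of_nilpotent hn.neg

lemma LieAlgebra.commute_of_ad_pow_eq_zero [PerfectField F] {n s y : Module.End F V}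
    (hc : Commute n s) (hn : IsNilpotent n) (hs : s.IsSemisimple) {k : ℕ}
    (hy : (LieAlgebra.ad F _ (n + s) ^ k) y = 0) : Commute s y := by
  have := LieAlgebra.ad_apply_eq_smul_of_mem_maxGenEigenspace (μ := 0) hc hn hs
    ((Module.End.mem_maxGenEigenspace _ _ _).2 ⟨k, by simpa using hy⟩)
  rwa [zero_smul, LieAlgebra.ad_ofAssociative_apply, sub_eq_zero] at this

lemma LinearMap.eq_zero_of_forall_trace_mul_eq_zero {z : Module.End F V}
    (hz : ∀ x, LinearMap.trace F V (z * x) = 0) : z = 0 := by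
  ext v
  rw [LinearMap.zero_apply, ← Module.forall_dual_apply_eq_zero_iff F]
  intro g
  have := hz (g.smulRight v)
  rwa [show z * g.smulRight v = g.smulRight (z v) by ext; simp, LinearMap.trace_smulRight] at this

lemma LinearMap.exists_eq_trace_mul (f : Module.End F V →ₗ[F] F) :
    ∃ z : Module.End F V, ∀ x, f x = LinearMap.trace F V (z * x) := by
  let T : Module.End F V →ₗ[F] Module.Dual F (Module.End F V) :=
    (LinearMap.mul F (Module.End F V)).compr₂ (LinearMap.trace F V)
  have hT (z x) : T z x = LinearMap.trace F V (z * x) := rfl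
  have hinj : Function.Injective T := (injective_iff_map_eq_zero T).2 fun z hz ↦
    LinearMap.eq_zero_of_forall_trace_mul_eq_zero fun x ↦ LinearMap.congr_fun hz x
  obtain ⟨z, rfl⟩ := (LinearMap.injective_iff_surjective_of_finrank_eq_finrank
    (Subspace.dual_finrank_eq (K := F) (V := Module.End F V)).symm).1 hinj f
  exact ⟨z, hT z⟩

/-- A nilpotent polynomial in `a` lies in the range of `ad a`. -/
lemma LieAlgebra.exists_ad_apply_eq_of_isNilpotent {a n : Module.End F V}
    (hn : IsNilpotent n) (hna : n ∈ Algebra.adjoin F {a}) :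
    ∃ h, LieAlgebra.ad F _ a h = n := by
  by_contra hcon
  obtain ⟨f, hf, hker⟩ := Submodule.exists_le_ker_of_notMem
    (p := LinearMap.range (LieAlgebra.ad F (Module.End F V) a)) (v := n) hcon
  obtain ⟨z, hz⟩ := LinearMap.exists_eq_trace_mul f
  have hza : a * z = z * a := by
    refine sub_eq_zero.1 (LinearMap.eq_zero_of_forall_trace_mul_eq_zero fun x ↦ ?_)
    have hx : f (a * x - x * a) = 0 := hker ⟨x, rfl⟩
    rw [hz, mul_sub, map_sub, ← mul_assoc, ← mul_assoc, LinearMap.trace_mul_comm F (z * x) a,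
      ← mul_assoc] at hx
    rw [sub_mul, map_sub, ← neg_sub, hx, neg_zero]
  have hzn : Commute z n :=
    Algebra.commute_of_mem_adjoin_singleton_of_commute hna hza.symm
  refine hf ?_
  rw [hz]
  exact (LinearMap.isNilpotent_trace_of_isNilpotent (hzn.isNilpotent_mul_left hn)).eq_zero

lemma LieAlgebra.ad_pow_eq_zero_of_commute {R : Type*} [Ring R] [Algebra F R] {x y : R}
    (h : Commute x y) {k : ℕ} (hk : k ≠ 0) : (LieAlgebra.ad F R x ^ k) y = 0 := by
  obtain ⟨k, rfl⟩ := Nat.exists_eq_succ_of_ne_zero hk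
  rw [pow_succ, Module.End.mul_apply, LieAlgebra.ad_ofAssociative_apply, h.eq, sub_self, map_zero]

variable [CharZero F] {a b : Module.End F V} {k : ℕ}

lemma LieAlgebra.isSemisimple_of_ad_pow_eq_zero_iff (hk : 2 ≤ k)
    (hab : ∀ x, (LieAlgebra.ad F _ a ^ k) x = 0 ↔ (LieAlgebra.ad F _ x ^ k) b = 0)
    (hba : ∀ x, (LieAlgebra.ad F _ b ^ k) x = 0 ↔ (LieAlgebra.ad F _ x ^ k) a = 0) :
    a.IsSemisimple := by
  obtain ⟨n, hna, s, hsa, hn, hs, ha⟩ := a.exists_isNilpotent_isSemisimple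
  have hns : Commute n s := Algebra.commute_of_mem_adjoin_singleton_of_commute hsa
    (Algebra.commute_of_mem_adjoin_self hna).symm
  have han : Commute a n := Algebra.commute_of_mem_adjoin_self hna
  have sq_eq_zero {x : Module.End F V} (hx : LieAlgebra.ad F _ a x = -n) :
      (LieAlgebra.ad F _ a ^ 2) x = 0 := by
    rw [pow_succ, Module.End.mul_apply, hx]
    exact LieAlgebra.ad_pow_eq_zero_of_commute han.neg_right one_ne_zero
  obtain ⟨h, hah⟩ := LieAlgebra.exists_ad_apply_eq_of_isNilpotent hn.neg (neg_mem hna)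
  have hsh : Commute s h :=
    LieAlgebra.commute_of_ad_pow_eq_zero (k := 2) hns hn hs (by rw [← ha, sq_eq_zero hah])
  obtain ⟨m, hmh, t, hth, hm, ht, hmt⟩ := h.exists_isNilpotent_isSemisimple
  have hmt' : Commute m t := Algebra.commute_of_mem_adjoin_singleton_of_commute hth
    (Algebra.commute_of_mem_adjoin_self hmh).symm
  have hhn : LieAlgebra.ad F _ h n = n := by
    rw [LieAlgebra.ad_ofAssociative_apply] at hah ⊢
    rw [← neg_inj, ← hah, ha, add_mul, mul_add, hsh.eq]
    abel
  have htn : LieAlgebra.ad F _ t n = n := by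
    have := LieAlgebra.ad_apply_eq_smul_of_mem_maxGenEigenspace (μ := 1) hmt' hm ht
      ((Module.End.mem_maxGenEigenspace _ _ n).2 ⟨1, by simp [← hmt, hhn]⟩)
    rwa [one_smul] at this
  have hst : Commute s t := Algebra.commute_of_mem_adjoin_singleton_of_commute hth hsh
  have hat : LieAlgebra.ad F _ a t = -n := by
    rw [LieAlgebra.ad_ofAssociative_apply] at htn ⊢
    rw [ha, add_mul, mul_add, hst.eq]
    nth_rewrite 3 [← htn]
    abel
  have commute_of {y : Module.End F V} (hy : (LieAlgebra.ad F _ t ^ k) y = 0) : Commute t y :=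
    LieAlgebra.commute_of_ad_pow_eq_zero (k := k) (Commute.zero_left t) .zero ht
      (by rwa [zero_add])
  have hakt : (LieAlgebra.ad F _ a ^ k) t = 0 := by
    rw [← Nat.sub_add_cancel hk, pow_add, Module.End.mul_apply, sq_eq_zero hat, map_zero]
  have htb : Commute t b := commute_of ((hab t).1 hakt)
  have hta : Commute t a :=
    commute_of ((hba t).1 (LieAlgebra.ad_pow_eq_zero_of_commute htb.symm (by omega)))
  have hn0 : n = 0 := by
    rw [← neg_eq_zero, ← hat, LieAlgebra.ad_ofAssociative_apply, hta.eq, sub_self]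
  rwa [ha, hn0, zero_add]

lemma LieAlgebra.commute_of_ad_pow_eq_zero_iff (hk : 0 < k)
    (hab : ∀ x, (LieAlgebra.ad F _ a ^ k) x = 0 ↔ (LieAlgebra.ad F _ x ^ k) b = 0)
    (hba : ∀ x, (LieAlgebra.ad F _ b ^ k) x = 0 ↔ (LieAlgebra.ad F _ x ^ k) a = 0)
    {c : Module.End F V} (hc : Commute a c) : Commute b c := by
  have hbc := (hba c).2 (LieAlgebra.ad_pow_eq_zero_of_commute hc.symm hk.ne')
  obtain rfl | hk2 : k = 1 ∨ 2 ≤ k := by omega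
  · rwa [pow_one, LieAlgebra.ad_ofAssociative_apply, sub_eq_zero] at hbc
  · exact LieAlgebra.commute_of_ad_pow_eq_zero (k := k) (Commute.zero_left b) .zero
      (LieAlgebra.isSemisimple_of_ad_pow_eq_zero_iff hk2 hba hab) (by rwa [zero_add])

theorem LieAlgebra.mem_adjoin_singleton_of_ad_pow_eq_zero_iff (hk : 0 < k)
    (hab : ∀ x, (LieAlgebra.ad F _ a ^ k) x = 0 ↔ (LieAlgebra.ad F _ x ^ k) b = 0)
    (hba : ∀ x, (LieAlgebra.ad F _ b ^ k) x = 0 ↔ (LieAlgebra.ad F _ x ^ k) a = 0) :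
    b ∈ Algebra.adjoin F {a} :=
  Module.End.mem_adjoin_singleton_of_forall_commute fun _ ↦
    LieAlgebra.commute_of_ad_pow_eq_zero_iff hk hab hba

end AdjointAction

section Matrix

variable {n : ℕ} {F : Type*} [Field F]

lemma toLinAlgEquiv'_adFun_iterate (A X : Matrix (Fin n) (Fin n) F) (k : ℕ) :
    Matrix.toLinAlgEquiv' ((adFun A)^[k] X) =
      (LieAlgebra.ad F _ (Matrix.toLinAlgEquiv' A) ^ k) (Matrix.toLinAlgEquiv' X) := by
  induction k with
  | zero => simp
  | succ k ih =>
    rw [Function.iterate_succ_apply', pow_succ', Module.End.mul_apply, ← ih,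
      LieAlgebra.ad_ofAssociative_apply, adFun, map_sub, map_mul, map_mul]

lemma ad_pow_eq_zero_iff_of_kerAdPow_eq_annPow {A B : Matrix (Fin n) (Fin n) F} {k : ℕ}
    (h : kerAdPow A k = annPow B k) (x : Module.End F (Fin n → F)) :
    (LieAlgebra.ad F _ (Matrix.toLinAlgEquiv' A) ^ k) x = 0 ↔
      (LieAlgebra.ad F _ x ^ k) (Matrix.toLinAlgEquiv' B) = 0 := by
  obtain ⟨X, rfl⟩ := Matrix.toLinAlgEquiv'.surjective x
  rw [← toLinAlgEquiv'_adFun_iterate, ← toLinAlgEquiv'_adFun_iterate,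
    EmbeddingLike.map_eq_zero_iff, EmbeddingLike.map_eq_zero_iff]
  exact Set.ext_iff.1 h X

lemma exists_eq_aeval_of_kerAdPow_eq_annPow [CharZero F] {A B : Matrix (Fin n) (Fin n) F} {k : ℕ}
    (hk : 0 < k) (h1 : kerAdPow A k = annPow B k) (h2 : kerAdPow B k = annPow A k) :
    ∃ f : F[X], B = aeval A f := by
  have := LieAlgebra.mem_adjoin_singleton_of_ad_pow_eq_zero_iff hk
    (ad_pow_eq_zero_iff_of_kerAdPow_eq_annPow h1) (ad_pow_eq_zero_iff_of_kerAdPow_eq_annPow h2)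
  rw [Algebra.adjoin_singleton_eq_range_aeval] at this
  obtain ⟨f, hf⟩ := this
  refine ⟨f, Matrix.toLinAlgEquiv'.injective ?_⟩
  rw [← hf]
  exact aeval_algHom_apply (Matrix.toLinAlgEquiv' (R := F) (n := Fin n)).toAlgHom A f

end Matrix

theorem polyEquiv_of_kerAdPow_eq_annPow {n : ℕ} {F : Type*} [Field F] [CharZero F]
    (A B : Matrix (Fin n) (Fin n) F) (k : ℕ) (hk : 0 < k)
    (h1 : kerAdPow A k = annPow B k) (h2 : kerAdPow B k = annPow A k) :
    PolyEquiv A B := by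
  obtain ⟨f, hf⟩ := exists_eq_aeval_of_kerAdPow_eq_annPow hk h1 h2
  obtain ⟨g, hg⟩ := exists_eq_aeval_of_kerAdPow_eq_annPow hk h2 h1
  exact ⟨f, g, hf, hg⟩
end

section
/- Let F be a field of characteristic zero and let A, B ∈ Mₙ(F). If 𝒞𝓛(A) = 𝒞𝓛(B) and 𝒞𝓛(A) contains an invertible matrix, then A and B are odd polynomially equivalent. -/
/-- The clifforder of a matrix `A`: all matrices anti-commuting with `A`. -/
def clifforder {n : ℕ} {F : Type*} [Field F] (A : Matrix (Fin n) (Fin n) F) :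
    Set (Matrix (Fin n) (Fin n) F) :=
  {X | A * X = -(X * A)}

/-- `A` and `B` are odd polynomially equivalent: each is an odd polynomial in the other. -/
def OddPolyEquiv {n : ℕ} {F : Type*} [Field F] (A B : Matrix (Fin n) (Fin n) F) : Prop :=
  ∃ f g : Polynomial F,
    (∀ i ∈ f.support, Odd i) ∧ (∀ i ∈ g.support, Odd i) ∧
    B = Polynomial.aeval A f ∧ A = Polynomial.aeval B g

open Polynomial in
/-- A vector whose order is the minimal polynomial. -/
theorem Module.End.exists_aeval_apply_eq_zero_imp {F V : Type*} [Field F] [AddCommGroup V]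
    [Module F V] [FiniteDimensional F V] (a : Module.End F V) :
    ∃ w : V, ∀ p : F[X], aeval a p w = 0 → aeval a p = 0 := by
  obtain ⟨x, hx⟩ := Module.exists_ker_toSpanSingleton_eq_annihilator F[X] (Module.AEval' a)
  have hsmul : ∀ (p : F[X]) (y : Module.AEval' a),
      (Module.AEval'.of a).symm (p • y) = aeval a p ((Module.AEval'.of a).symm y) :=
    fun p y => Module.AEval.of_symm_smul a p y
  refine ⟨(Module.AEval'.of a).symm x, fun p hp => ?_⟩
  have h1 : p ∈ LinearMap.ker (LinearMap.toSpanSingleton F[X] (Module.AEval' a) x) := by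
    rw [LinearMap.mem_ker, LinearMap.toSpanSingleton_apply]
    apply (Module.AEval'.of a).symm.injective
    rw [map_zero, ← hp, hsmul]
  rw [hx] at h1
  refine LinearMap.ext fun v => ?_
  have h2 := hsmul p (Module.AEval'.of a v)
  rwa [Module.mem_annihilator.mp h1, map_zero, LinearEquiv.symm_apply_apply, eq_comm] at h2

open Polynomial in
theorem Polynomial.coeff_iterate_divX {R : Type*} [Semiring R] (p : R[X]) (i k : ℕ) :
    (divX^[i] p).coeff k = p.coeff (k + i) := by
  induction i generalizing k with
  | zero => rfl
  | succ i ih => rw [Function.iterate_succ_apply', coeff_divX, ih, add_assoc, add_comm 1 i]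

open Polynomial in
/-- A vector whose order is the minimal polynomial can be mapped to any vector by an endomorphism
with values in the cyclic subspace of that vector, commuting with the given one. -/
theorem Module.End.exists_commute_apply_eq {F V : Type*} [Field F] [AddCommGroup V]
    [Module F V] [FiniteDimensional F V] [Nontrivial V] (a : Module.End F V) (w : V)
    (hw : ∀ p : F[X], aeval a p w = 0 → aeval a p = 0) (u : V) :
    ∃ c : Module.End F V, Commute a c ∧ c w = u ∧ ∀ x, ∃ p : F[X], c x = aeval a p u := by
  set m := minpoly F a with hm
  have hmon : m.Monic := minpoly.monic (Algebra.IsIntegral.isIntegral a)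
  obtain ⟨d, hd⟩ : ∃ d, m.natDegree = d + 1 :=
    Nat.exists_eq_succ_of_ne_zero (minpoly.natDegree_pos (Algebra.IsIntegral.isIntegral a)).ne'
  -- a functional reading off the top coefficient on the cyclic subspace of `w`
  obtain ⟨l, hl⟩ : ∃ l : V →ₗ[F] F, ∀ i ≤ d, l ((a ^ i) w) = if i = d then 1 else 0 := by
    let T : degreeLT F (d + 1) →ₗ[F] V :=
      (LinearMap.applyₗ w ∘ₗ (aeval a).toLinearMap) ∘ₗ (degreeLT F (d + 1)).subtype
    have hT : LinearMap.ker T = ⊥ := by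
      rw [LinearMap.ker_eq_bot']
      intro p hp
      by_contra hne
      have hp0 : (p : F[X]) ≠ 0 := fun h0 => hne (Subtype.ext h0)
      have h1 := minpoly.degree_le_of_ne_zero F a hp0 (hw p hp)
      have h2 := mem_degreeLT.mp p.2
      rw [← hm, degree_eq_natDegree hmon.ne_zero, hd] at h1
      exact absurd (lt_of_le_of_lt h1 h2) (lt_irrefl _)
    obtain ⟨g, hg⟩ := T.exists_leftInverse_of_injective hT
    refine ⟨lcoeff F d ∘ₗ (degreeLT F (d + 1)).subtype ∘ₗ g, fun i hi => ?_⟩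
    have hmem : (X ^ i : F[X]) ∈ degreeLT F (d + 1) := by
      rw [mem_degreeLT, degree_X_pow]
      exact_mod_cast Nat.lt_succ_of_le hi
    have hTi : T ⟨X ^ i, hmem⟩ = (a ^ i) w := by simp [T]
    rw [← hTi, LinearMap.comp_apply, LinearMap.comp_apply, ← LinearMap.comp_apply g T, hg]
    simp [coeff_X_pow, eq_comm]
  let e : ℕ → F[X] := fun i => divX^[i] m
  have he0 : aeval a (e 0) = 0 := minpoly.aeval F a
  have hed : e (d + 1) = 1 := by
    ext k
    rw [coeff_iterate_divX, coeff_one]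
    split_ifs with hk
    · rw [hk, zero_add, ← hd]; exact hmon
    · exact coeff_eq_zero_of_natDegree_lt (by omega)
  have hstep : ∀ i v, a (aeval a (e (i + 1)) v) = aeval a (e i) v - m.coeff i • v := by
    intro i v
    have h1 := divX_mul_X_add (e i)
    have h2 : (e i).divX = e (i + 1) := (Function.iterate_succ_apply' _ _ _).symm
    have h3 : (e i).coeff 0 = m.coeff i := by rw [coeff_iterate_divX, zero_add]
    rw [h2, h3, mul_comm] at h1
    conv_rhs => rw [← h1]
    simp [Algebra.algebraMap_eq_smul_one]
  let c : Module.End F V :=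
    ∑ i ∈ Finset.range (d + 1), (l ∘ₗ (a ^ i)).smulRight (aeval a (e (i + 1)) u)
  have hc : ∀ x, c x = ∑ i ∈ Finset.range (d + 1), l ((a ^ i) x) • aeval a (e (i + 1)) u := by
    intro x; simp [c, LinearMap.sum_apply]
  refine ⟨c, ?_, ?_, fun x => ?_⟩
  · refine LinearMap.ext fun x => ?_
    rw [Module.End.mul_apply, Module.End.mul_apply, hc, hc, map_sum]
    have hx : ∑ i ∈ Finset.range (d + 1), l ((a ^ i) x) * m.coeff i = - l ((a ^ (d + 1)) x) := by
      have h1 : aeval a m x = 0 := by rw [minpoly.aeval]; rfl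
      have h2 := congrArg l h1
      rw [aeval_eq_sum_range, hd, Finset.sum_range_succ, ← hd, hmon.coeff_natDegree, hd] at h2
      simp only [LinearMap.add_apply, LinearMap.sum_apply, LinearMap.smul_apply, map_add, map_sum,
        map_smul, one_smul, map_zero, smul_eq_mul] at h2
      rw [← eq_neg_of_add_eq_zero_left h2]
      exact Finset.sum_congr rfl fun i _ => mul_comm _ _
    have hl1 : ∀ i ∈ Finset.range (d + 1), a (l ((a ^ i) x) • aeval a (e (i + 1)) u) =
        l ((a ^ i) x) • aeval a (e i) u - (l ((a ^ i) x) * m.coeff i) • u := by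
      intro i _
      rw [map_smul, hstep, smul_sub, smul_smul]
    have hr1 : ∀ i, (a ^ i) (a x) = (a ^ (i + 1)) x := fun i => by
      rw [pow_succ, Module.End.mul_apply]
    rw [Finset.sum_congr rfl hl1, Finset.sum_sub_distrib, ← Finset.sum_smul, hx]
    simp only [hr1]
    have h4 := Finset.sum_range_succ (fun i => l ((a ^ i) x) • aeval a (e i) u) (d + 1)
    rw [Finset.sum_range_succ', he0, hed] at h4
    rw [LinearMap.zero_apply, smul_zero, add_zero, map_one, Module.End.one_apply] at h4
    rw [h4, neg_smul, sub_neg_eq_add]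
  · rw [hc, Finset.sum_eq_single_of_mem d (Finset.self_mem_range_succ d)]
    · rw [hl d le_rfl, if_pos rfl, hed]; simp
    · intro i hi hne
      rw [hl i (Finset.mem_range_succ_iff.mp hi), if_neg hne, zero_smul]
  · refine ⟨∑ i ∈ Finset.range (d + 1), C (l ((a ^ i) x)) * e (i + 1), ?_⟩
    rw [hc]
    simp [LinearMap.sum_apply, Algebra.algebraMap_eq_smul_one]

theorem SemiconjBy.aeval_right {R S : Type*} [CommSemiring R] [Semiring S] [Algebra R S]
    {s a b : S} (h : SemiconjBy s a b) (f : Polynomial R) :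
    SemiconjBy s (Polynomial.aeval a f) (Polynomial.aeval b f) := by
  induction f using Polynomial.induction_on' with
  | add p q hp hq => simpa using hp.add_right hq
  | monomial k r =>
    simpa [Polynomial.aeval_monomial] using
      SemiconjBy.mul_right (Algebra.commutes r s).symm (h.pow_right k)

/-- Double centralizer theorem for a single endomorphism. -/
theorem Module.End.exists_eq_aeval_of_forall_commute {F V : Type*} [Field F] [AddCommGroup V]
    [Module F V] [FiniteDimensional F V] (a b : Module.End F V)
    (h : ∀ c, Commute a c → Commute b c) : ∃ f : Polynomial F, b = Polynomial.aeval a f := by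
  cases subsingleton_or_nontrivial V with
  | inl _ => exact ⟨0, Subsingleton.elim _ _⟩
  | inr _ =>
    obtain ⟨w, hw⟩ := a.exists_aeval_apply_eq_zero_imp
    obtain ⟨c, hac, hcw, hc⟩ := a.exists_commute_apply_eq w hw w
    obtain ⟨f, hf⟩ := hc (b w)
    have hbw : b w = Polynomial.aeval a f w := by
      rw [← hf, ← Module.End.mul_apply, ← (h c hac).eq, Module.End.mul_apply, hcw]
    refine ⟨f, LinearMap.ext fun u => ?_⟩
    obtain ⟨c, hac, rfl, -⟩ := a.exists_commute_apply_eq w hw u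
    have hfc : Commute (Polynomial.aeval a f) c := (SemiconjBy.aeval_right hac.symm f).symm
    rw [← Module.End.mul_apply, (h c hac).eq, ← Module.End.mul_apply, hfc.eq,
      Module.End.mul_apply, Module.End.mul_apply, hbw]

theorem Matrix.exists_eq_aeval_of_forall_commute {n F : Type*} [Fintype n] [DecidableEq n]
    [Field F] (A B : Matrix n n F) (h : ∀ C, Commute A C → Commute B C) :
    ∃ f : Polynomial F, B = Polynomial.aeval A f := by
  let φ : Matrix n n F ≃ₐ[F] Module.End F (n → F) := Matrix.toLinAlgEquiv'
  obtain ⟨f, hf⟩ := Module.End.exists_eq_aeval_of_forall_commute (φ A) (φ B) fun c hc => by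
    have h1 : Commute A (φ.symm c) := by simpa using hc.map φ.symm
    simpa using (h _ h1).map φ
  refine ⟨f, φ.injective ?_⟩
  rw [hf, Polynomial.aeval_algHom_apply]

/-- Only the odd part of a polynomial `f` contributes to `f(a)` if `f(-a) = -f(a)`. -/
theorem Polynomial.exists_odd_aeval_eq {F S : Type*} [Field F] [CharZero F] [Ring S] [Algebra F S]
    (a : S) (f : Polynomial F) (h : aeval (-a) f = -aeval a f) :
    ∃ g : Polynomial F, (∀ i ∈ g.support, Odd i) ∧ aeval a f = aeval a g := by
  refine ⟨C (2⁻¹ : F) * (f - f.comp (-X)), fun i hi => ?_, ?_⟩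
  · by_contra hodd
    refine mem_support_iff.mp hi ?_
    have hX : (-X : Polynomial F) = C (-1) * X := by simp
    rw [coeff_C_mul, coeff_sub, hX, comp_C_mul_X_coeff, (Nat.not_odd_iff_even.mp hodd).neg_one_pow]
    simp
  · have h2 : (2⁻¹ : F) * 2 = 1 := inv_mul_cancel₀ two_ne_zero
    rw [map_mul, map_sub, aeval_comp, map_neg, aeval_X, h, aeval_C, sub_neg_eq_add, ← two_mul,
      ← mul_assoc, ← map_ofNat (algebraMap F S) 2, ← map_mul, h2, map_one, one_mul]

theorem exists_odd_eq_aeval_of_clifforder_subset {n : ℕ} {F : Type*} [Field F] [CharZero F]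
    {A B P : Matrix (Fin n) (Fin n) F} (h : clifforder A ⊆ clifforder B)
    (hP : P ∈ clifforder A) (hPu : IsUnit P) :
    ∃ f : Polynomial F, (∀ i ∈ f.support, Odd i) ∧ B = Polynomial.aeval A f := by
  have hA : A * P = -(P * A) := hP
  have hB : B * P = -(P * B) := h hP
  obtain ⟨f, rfl⟩ := Matrix.exists_eq_aeval_of_forall_commute A B fun C hC => by
    have h1 : P * C ∈ clifforder A := by
      change A * (P * C) = -(P * C * A)
      rw [← mul_assoc, hA, neg_mul, mul_assoc, hC.eq, mul_assoc]
    have h2 : B * (P * C) = -(P * C * B) := h h1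
    rw [← mul_assoc, hB, neg_mul, neg_inj, mul_assoc, mul_assoc] at h2
    exact hPu.mul_left_cancel h2
  have hsemi : SemiconjBy P (-A) A := by
    rw [SemiconjBy, hA, mul_neg]
  refine Polynomial.exists_odd_aeval_eq A f (hPu.mul_left_cancel ?_)
  rw [(hsemi.aeval_right f).eq, hB, mul_neg]

theorem oddPolyEquiv_of_clifforder_eq {n : ℕ} {F : Type*} [Field F] [CharZero F]
    (A B : Matrix (Fin n) (Fin n) F)
    (h : clifforder A = clifforder B)
    (hinv : ∃ P ∈ clifforder A, IsUnit P) :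
    OddPolyEquiv A B := by
  obtain ⟨P, hP, hPu⟩ := hinv
  obtain ⟨f, hf, hB⟩ := exists_odd_eq_aeval_of_clifforder_subset h.subset hP hPu
  obtain ⟨g, hg, hA⟩ := exists_odd_eq_aeval_of_clifforder_subset h.symm.subset (h ▸ hP) hPu
  exact ⟨f, g, hf, hg, hB, hA⟩
end
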